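/- Let B ≥ 1 be an integer and let X be a random variable taking values in the lattice G = {0, 1/B, 2/B, ..., 1} whose probability mass function is unimodal. Let η = E[X], suppose η > 1/3, and define d = −2(η − 1/2)(6η + 1) + (2 − 4η)/B + (4η − 1)²/B². Suppose d ≤ 0. Then for every t = j/B ∈ G with η < t ≤ 1, one has P(X ≥ t) ≤ (2η − t + 1/B)/(t + 1/B). -/

import Mathlib

open MeasureTheory

/-- A probability mass function `f` on the lattice `{0, 1/B, ..., 1}` (indexed by
`{0, 1, ..., B}`) is unimodal if it increases up to some mode `m ≤ B` and decreases
afterwards. -/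
def UnimodalOn (B : ℕ) (f : ℕ → ℝ) : Prop :=
  ∃ m ≤ B, (∀ i j, i ≤ j → j ≤ m → f i ≤ f j) ∧ (∀ i j, m ≤ i → i ≤ j → j ≤ B → f j ≤ f i)

open Finset in
/-- One-sided Abel inequality for an antitone nonnegative weight. -/
lemma sum_antitone_mul_le (n : ℕ) : ∀ (h g : ℕ → ℝ) (H D : ℝ),
    (∀ i < n, 0 ≤ h i) → (∀ i < n, h i ≤ H) → (∀ i k, i ≤ k → k < n → h k ≤ h i) →
    (∀ k ≤ n, H * ∑ i ∈ range k, g i ≤ D) → ∑ i ∈ range n, h i * g i ≤ D := by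
  induction n with
  | zero =>
    intro h g H D _ _ _ hD
    simpa using hD 0 le_rfl
  | succ n ih =>
    intro h g H D h0 hH hanti hD
    have hD0 : 0 ≤ D := by simpa using hD 0 (Nat.zero_le _)
    have hh0 := h0 0 n.succ_pos
    have hhH := hH 0 n.succ_pos
    have key : ∀ k ≤ n, h 0 * ∑ i ∈ range k, g (i + 1) ≤ D - h 0 * g 0 := by
      intro k hk
      have hk' := hD (k + 1) (by omega)
      rw [sum_range_succ'] at hk'
      rcases le_total 0 (∑ i ∈ range k, g (i + 1) + g 0) with hs | hs
      · nlinarith [mul_le_mul_of_nonneg_right hhH hs]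
      · nlinarith [mul_nonpos_of_nonneg_of_nonpos hh0 hs]
    have := ih (fun i => h (i + 1)) (fun i => g (i + 1)) (h 0) (D - h 0 * g 0)
      (fun i hi => h0 _ (by omega)) (fun i hi => hanti _ _ (by omega) (by omega))
      (fun i k hik hk => hanti _ _ (by omega) (by omega)) key
    rw [sum_range_succ']
    linarith

open Finset in
/-- If `g` has nonpositive sum over every interval containing `m`, then so has its product with
any nonnegative weight that is unimodal with mode `m`. -/
lemma sum_unimodal_mul_nonpos (B m : ℕ) (hm : m ≤ B) (f g : ℕ → ℝ) (hf : ∀ i, 0 ≤ f i)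
    (hmono : ∀ i j, i ≤ j → j ≤ m → f i ≤ f j)
    (hanti : ∀ i j, m ≤ i → i ≤ j → j ≤ B → f j ≤ f i)
    (hg : ∀ a b, a ≤ m → m ≤ b → b ≤ B → ∑ i ∈ Ico a (b + 1), g i ≤ 0) :
    ∑ i ∈ range (B + 1), f i * g i ≤ 0 := by
  have split : ∑ i ∈ range (B + 1), f i * g i = ∑ i ∈ range m, f (m - 1 - i) * g (m - 1 - i) +
      f m * g m + ∑ i ∈ range (B - m), f (m + 1 + i) * g (m + 1 + i) := by
    rw [sum_range_reflect (fun i => f i * g i), ← sum_range_succ (fun i => f i * g i),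
      show B - m = B + 1 - (m + 1) by omega, ← sum_Ico_eq_sum_range (fun i => f i * g i),
      sum_range_add_sum_Ico _ (by omega)]
  have right : ∀ a ≤ m, ∑ i ∈ range (B - m), f (m + 1 + i) * g (m + 1 + i) ≤
      -(f m * ∑ i ∈ Ico a (m + 1), g i) := by
    intro a ha
    refine sum_antitone_mul_le _ (fun i => f (m + 1 + i)) (fun i => g (m + 1 + i)) (f m) _
      (fun i _ => hf _) (fun i hi => hanti _ _ le_rfl (by omega) (by omega))
      (fun i k hik hk => hanti _ _ (by omega) (by omega) (by omega)) fun k hk => ?_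
    have h := hg a (m + k) ha (by omega) (by omega)
    rw [← sum_Ico_consecutive g (show a ≤ m + 1 by omega) (by omega),
      sum_Ico_eq_sum_range g (m + 1), show m + k + 1 - (m + 1) = k by omega] at h
    nlinarith [mul_nonpos_of_nonneg_of_nonpos (hf m) h]
  have left : ∑ i ∈ range m, f (m - 1 - i) * g (m - 1 - i) ≤
      -(f m * g m + ∑ i ∈ range (B - m), f (m + 1 + i) * g (m + 1 + i)) := by
    refine sum_antitone_mul_le _ (fun i => f (m - 1 - i)) (fun i => g (m - 1 - i)) (f m) _
      (fun i _ => hf _) (fun i hi => hmono _ _ (by omega) le_rfl)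
      (fun i k hik hk => hmono _ _ (by omega) (by omega)) fun k hk => ?_
    have h := right (m - k) (by omega)
    have hrefl : ∑ i ∈ range k, g (m - 1 - i) = ∑ i ∈ Ico (m - k) m, g i := by
      rw [sum_Ico_eq_sum_range, show m - (m - k) = k by omega, ← sum_range_reflect]
      refine sum_congr rfl fun i hi => ?_
      rw [mem_range] at hi
      congr 1
      omega
    rw [sum_Ico_succ_top (by omega)] at h
    rw [hrefl]
    linarith
  rw [split]
  linarith

open Finset in
/-- Sum of the dual certificate over an initial segment. -/
lemma sum_range_certificate (B j n : ℕ) (σ : ℝ) :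
    ∑ i ∈ range n, ((if j ≤ i then (j : ℝ) + 1 else 0) - (2 * i - j + 1) +
      (1 - σ) * (2 * i - B)) =
      (j + 1) * ((n - j : ℕ) : ℝ) - (n * (n - 1) - (j - 1) * n) +
        (1 - σ) * (n * (n - 1) - B * n) := by
  induction n with
  | zero => simp
  | succ n ih =>
    rw [sum_range_succ, ih]
    split_ifs with h
    · rw [Nat.succ_sub h]
      push_cast
      ring
    · rw [Nat.sub_eq_zero_of_le (by omega), Nat.sub_eq_zero_of_le (by omega)]
      push_cast
      ring

open Finset in
lemma sum_Ico_certificate_nonpos_of_le_mode (B j m a b : ℕ) (hjm : j ≤ m) (ha : a ≤ m)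
    (hb : m ≤ b) :
    ∑ i ∈ Ico a (b + 1), ((if j ≤ i then (j : ℝ) + 1 else 0) - (2 * i - j + 1) +
      (1 - (1 : ℝ)) * (2 * i - B)) ≤ 0 := by
  rw [sum_Ico_eq_sub _ (by omega), sum_range_certificate, sum_range_certificate,
    Nat.cast_sub (by omega)]
  have h1 : (j : ℝ) ≤ m := by exact_mod_cast hjm
  have h2 : (a : ℝ) ≤ m := by exact_mod_cast ha
  have h3 : (m : ℝ) ≤ b := by exact_mod_cast hb
  have ha0 : (0 : ℝ) ≤ a := a.cast_nonneg
  have hj0 : (0 : ℝ) ≤ j := j.cast_nonneg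
  rcases le_total a j with haj | haj
  · have h4 : (a : ℝ) ≤ j := by exact_mod_cast haj
    rw [Nat.sub_eq_zero_of_le haj]
    push_cast
    nlinarith [mul_nonneg ha0 (sub_nonneg.2 h4), mul_nonneg (sub_nonneg.2 (h1.trans h3))
      (sub_nonneg.2 (h1.trans h3))]
  · have h4 : (j : ℝ) ≤ a := by exact_mod_cast haj
    rw [Nat.cast_sub haj]
    push_cast
    nlinarith [mul_nonneg (show (0 : ℝ) ≤ b - a + 1 by linarith)
      (show (0 : ℝ) ≤ a + b - 2 * j by linarith)]

open Finset in
lemma sum_Ico_certificate_nonpos_of_mode_lt (B j m a b : ℕ) (hjB : j ≤ B) (hmj : m < j)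
    (ha : a ≤ m) (hb : m ≤ b) (hbB : b ≤ B) (σ : ℝ) (hσ : σ * (B - m) = B - j + 1) :
    ∑ i ∈ Ico a (b + 1), ((if j ≤ i then (j : ℝ) + 1 else 0) - (2 * i - j + 1) +
      (1 - σ) * (2 * i - B)) ≤ 0 := by
  rw [sum_Ico_eq_sub _ (by omega), sum_range_certificate, sum_range_certificate,
    Nat.sub_eq_zero_of_le (show a ≤ j by omega)]
  have hjB' : (j : ℝ) ≤ B := by exact_mod_cast hjB
  have h1 : (m : ℝ) + 1 ≤ j := by exact_mod_cast hmj
  have h2 : (a : ℝ) ≤ m := by exact_mod_cast ha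
  have h3 : (m : ℝ) ≤ b := by exact_mod_cast hb
  have h4 : (b : ℝ) ≤ B := by exact_mod_cast hbB
  have ha0 : (0 : ℝ) ≤ a := a.cast_nonneg
  have hσ0 : 0 ≤ σ := by
    by_contra! h
    nlinarith
  suffices h : ((j : ℝ) + 1) * ((b + 1 - j : ℕ) : ℝ) ≤ σ * ((b - a + 1) * (a + b - m)) by
    push_cast
    linear_combination h + (b - a + 1 : ℝ) * hσ
  rcases lt_or_ge b j with hbj | hbj
  · rw [Nat.sub_eq_zero_of_le (by omega), Nat.cast_zero, mul_zero]
    exact mul_nonneg hσ0 (mul_nonneg (by linarith) (by linarith))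
  · have h5 : (j : ℝ) ≤ b := by exact_mod_cast hbj
    rw [Nat.cast_sub (by omega)]
    push_cast
    have hquad : ((b : ℝ) + 1) * (b - m) ≤ (b - a + 1) * (a + b - m) := by
      nlinarith [mul_nonneg ha0 (show (0 : ℝ) ≤ 1 + m - a by linarith)]
    have hlin : (b : ℝ) + 1 - j ≤ σ * (b - m) := by
      have hpos : (0 : ℝ) < B - m := by linarith
      refine le_of_mul_le_mul_right ?_ hpos
      nlinarith [mul_nonneg (sub_nonneg.2 h4) (show (0 : ℝ) ≤ j - 1 - m by linarith)]
    calc ((j : ℝ) + 1) * (b + 1 - j) ≤ (b + 1) * (b + 1 - j) :=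
          mul_le_mul_of_nonneg_right (by linarith) (by linarith)
      _ ≤ (b + 1) * (σ * (b - m)) := mul_le_mul_of_nonneg_left hlin (by linarith)
      _ = σ * ((b + 1) * (b - m)) := by ring
      _ ≤ _ := mul_le_mul_of_nonneg_left hquad hσ0

open Finset in
/-- Markov's inequality for unimodal weights on `{0, ..., B}` with mean at least `B / 2`. -/
lemma UnimodalOn.tail_sum_le {B j : ℕ} (hjB : j ≤ B) {f : ℕ → ℝ} (hf : ∀ i, 0 ≤ f i)
    (huni : UnimodalOn B f) (hsum : ∑ i ∈ range (B + 1), f i = 1)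
    (hmean : (B : ℝ) ≤ 2 * ∑ i ∈ range (B + 1), f i * i) :
    (j + 1) * ∑ i ∈ range (B + 1), f i * (if j ≤ i then 1 else 0) ≤
      2 * ∑ i ∈ range (B + 1), f i * i - j + 1 := by
  obtain ⟨m, hm, hmono, hanti⟩ := huni
  obtain ⟨σ, hσ1, hg⟩ : ∃ σ : ℝ, σ ≤ 1 ∧ ∀ a b, a ≤ m → m ≤ b → b ≤ B →
      ∑ i ∈ Ico a (b + 1), ((if j ≤ i then (j : ℝ) + 1 else 0) - (2 * i - j + 1) +
        (1 - σ) * (2 * i - B)) ≤ 0 := by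
    rcases le_or_gt j m with hjm | hmj
    · exact ⟨1, le_rfl, fun a b ha hb _ =>
        sum_Ico_certificate_nonpos_of_le_mode B j m a b hjm ha hb⟩
    · have h1 : (m : ℝ) + 1 ≤ j := by exact_mod_cast hmj
      have h2 : (j : ℝ) ≤ B := by exact_mod_cast hjB
      have hpos : (0 : ℝ) < B - m := by linarith
      exact ⟨(B - j + 1) / (B - m), (div_le_one hpos).2 (by linarith), fun a b ha hb hbB =>
        sum_Ico_certificate_nonpos_of_mode_lt B j m a b hjB hmj ha hb hbB _
          (div_mul_cancel₀ _ hpos.ne')⟩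
  have key := sum_unimodal_mul_nonpos B m hm f _ hf hmono hanti hg
  have expand : ∑ i ∈ range (B + 1), f i * ((if j ≤ i then (j : ℝ) + 1 else 0) -
      (2 * i - j + 1) + (1 - σ) * (2 * i - B)) =
      (j + 1) * ∑ i ∈ range (B + 1), f i * (if j ≤ i then 1 else 0) -
        (2 * ∑ i ∈ range (B + 1), f i * i - (j - 1) * ∑ i ∈ range (B + 1), f i) +
        (1 - σ) * (2 * ∑ i ∈ range (B + 1), f i * i - B * ∑ i ∈ range (B + 1), f i) := by
    simp only [mul_sum, ← sum_sub_distrib, ← sum_add_distrib]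
    refine sum_congr rfl fun i _ => ?_
    split_ifs <;> ring
  rw [expand, hsum] at key
  nlinarith [mul_nonneg (sub_nonneg.2 hσ1) (sub_nonneg.2 hmean)]

open Finset in
/-- The expectation of a function of a lattice variable is a finite sum. -/
lemma integral_comp_lattice {Ω : Type*} [MeasurableSpace Ω] (P : Measure Ω)
    [IsProbabilityMeasure P] (B : ℕ) (hB : 1 ≤ B) (X : Ω → ℝ) (hX : Measurable X)
    (hlat : ∀ ω, ∃ i ≤ B, X ω = (i : ℝ) / B) (φ : ℝ → ℝ) :
    ∫ ω, φ (X ω) ∂P =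
      ∑ i ∈ range (B + 1), (P {ω | X ω = (i : ℝ) / B}).toReal * φ ((i : ℝ) / B) := by
  have hB0 : (B : ℝ) ≠ 0 := by positivity
  have hmeas : ∀ i : ℕ, MeasurableSet {ω | X ω = (i : ℝ) / B} := fun i =>
    hX (measurableSet_singleton _)
  have hpt : ∀ ω, φ (X ω) = ∑ i ∈ range (B + 1),
      {ω | X ω = (i : ℝ) / B}.indicator (fun _ => φ ((i : ℝ) / B)) ω := by
    intro ω
    obtain ⟨k, hk, hXk⟩ := hlat ω
    rw [sum_eq_single_of_mem k (mem_range.2 (by omega))]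
    · rw [Set.indicator_of_mem (by exact hXk), hXk]
    · intro i _ hik
      refine Set.indicator_of_notMem (fun h => hik ?_) _
      have h' : (i : ℝ) / B = k / B := h.symm.trans hXk
      exact_mod_cast (div_left_inj' hB0).1 h'
  simp_rw [hpt]
  rw [integral_finsetSum _ fun i _ => (integrable_const _).indicator (hmeas i)]
  refine sum_congr rfl fun i _ => ?_
  rw [integral_indicator_const _ (hmeas i), smul_eq_mul, Measure.real]

lemma half_le_of_discriminant_nonpos {B η : ℝ} (hB : 0 < B) (hη : 0 < η)
    (hd : -2 * (η - 1 / 2) * (6 * η + 1) + (2 - 4 * η) / B + (4 * η - 1) ^ 2 / B ^ 2 ≤ 0) :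
    1 / 2 ≤ η := by
  by_contra! h
  have h1 : 0 ≤ (2 - 4 * η) / B := div_nonneg (by linarith) hB.le
  have h2 : 0 ≤ (4 * η - 1) ^ 2 / B ^ 2 := by positivity
  nlinarith [mul_pos (show 0 < 1 / 2 - η by linarith) (show 0 < 6 * η + 1 by linarith)]

/-- Markov's inequality under unimodality (Theorem 3 of Shah & Samworth (2013)),
the case `η > 1/3`, `d ≤ 0`: for every `t = j/B` with `η < t ≤ 1`,
`P(X ≥ t) ≤ (2η - t + 1/B)/(t + 1/B)`. -/
theorem unimodal_markov_dnonpos {Ω : Type*} [MeasurableSpace Ω]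
    (P : Measure Ω) [IsProbabilityMeasure P]
    (B : ℕ) (hB : 1 ≤ B) (X : Ω → ℝ) (hXmeas : Measurable X)
    (hlat : ∀ ω, ∃ i ≤ B, X ω = (i : ℝ) / B)
    (huni : UnimodalOn B (fun i => (P {ω | X ω = (i : ℝ) / B}).toReal))
    (η : ℝ) (hη : η = ∫ ω, X ω ∂P) (hη3 : 1 / 3 < η)
    (d : ℝ)
    (hd : d = -2 * (η - 1 / 2) * (6 * η + 1) + (2 - 4 * η) / B + (4 * η - 1) ^ 2 / B ^ 2)
    (hdnonpos : d ≤ 0)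
    (j : ℕ) (hjB : j ≤ B) (t : ℝ) (ht : t = (j : ℝ) / B)
    (h1 : η < t) (h2 : t ≤ 1) :
    (P {ω | t ≤ X ω}).toReal ≤ (2 * η - t + 1 / B) / (t + 1 / B) := by
  have hB0 : (0 : ℝ) < B := by positivity
  have hη2 : 1 / 2 ≤ η :=
    half_le_of_discriminant_nonpos hB0 (by linarith) (hd ▸ hdnonpos)
  have E := integral_comp_lattice P B hB X hXmeas hlat
  have hsum := E fun _ => 1
  have hmean := E fun x => x * B
  have htail := E ({x | t ≤ x}.indicator fun _ => 1)
  simp only [integral_const, probReal_univ, smul_eq_mul, mul_one] at hsum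
  simp only [integral_mul_const, ← hη, div_mul_cancel₀ _ hB0.ne'] at hmean
  have hL : ∫ ω, ({x | t ≤ x}.indicator (fun _ => (1 : ℝ))) (X ω) ∂P =
      (P {ω | t ≤ X ω}).toReal :=
    integral_indicator_one (hXmeas measurableSet_Ici : MeasurableSet (X ⁻¹' Set.Ici t))
  have hind : ∀ i : ℕ, ({x | t ≤ x}.indicator (fun _ => (1 : ℝ))) ((i : ℝ) / B) =
      if j ≤ i then 1 else 0 := by
    intro i
    simp only [Set.indicator_apply, Set.mem_ofPred_eq, ht, div_le_div_iff_of_pos_right hB0,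
      Nat.cast_le]
  simp only [hL, hind] at htail
  have key := huni.tail_sum_le hjB (fun _ => ENNReal.toReal_nonneg) hsum.symm
    (by rw [← hmean]; nlinarith)
  rw [← hmean, ← htail] at key
  have hbound : (2 * η - t + 1 / B) / (t + 1 / B) = (2 * (η * B) - j + 1) / (j + 1) := by
    rw [ht]
    field_simp
  rw [hbound, le_div_iff₀ (by positivity)]
  linarith
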